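/- arXiv:1911.06765 — 2 statements merged into one kernel-verified Lean document; each statement's English description precedes it below -/
import Mathlib

section
/- Let θ ∈ ℝ be such that θ ≠ 1 and θ is not an integer ≥ 2 (so n + 1 − θ ≠ 0 for every natural number n ≥ 0), and let b > 0, c > 0. For every x with 0 < x < c/b, the function G(x) = (x^{1−θ} log(bx + c))/(1 − θ) + (1/(1−θ)) Σ_{n=1}^{∞} (−b/c)^n · x^{n+1−θ}/(n+1−θ) is well defined (the series converges absolutely) and has derivative G'(x) = x^{−θ} log(bx + c) at x. -/
open Real

/-- Lemma 1 of the paper, in power-series form: for `θ ≠ 1`, `θ` not an integer `≥ 2`, and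
`0 < x < c/b`, the function
`G(x) = x^{1−θ} log(bx+c)/(1−θ) + (1/(1−θ)) Σ_{n≥1} (−b/c)^n x^{n+1−θ}/(n+1−θ)`
is well defined (the series converges absolutely) and `G'(x) = x^{−θ} log(bx + c)`. -/
theorem hasDerivAt_log_antiderivative
    (θ b c : ℝ) (hθ1 : θ ≠ 1) (hθ : ∀ n : ℕ, (n : ℝ) + 1 - θ ≠ 0)
    (hb : 0 < b) (hc : 0 < c) (x : ℝ) (hx0 : 0 < x) (hx : x < c / b) :
    Summable (fun n : ℕ =>
      |(-b / c) ^ (n + 1) * x ^ ((n : ℝ) + 2 - θ) / ((n : ℝ) + 2 - θ)|) ∧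
    HasDerivAt
      (fun y : ℝ => y ^ (1 - θ) * Real.log (b * y + c) / (1 - θ)
        + (1 / (1 - θ))
          * ∑' n : ℕ, (-b / c) ^ (n + 1) * y ^ ((n : ℝ) + 2 - θ) / ((n : ℝ) + 2 - θ))
      (x ^ (-θ) * Real.log (b * x + c)) x := by
  have hbx : b * x < c := by
    rw [lt_div_iff₀ hb] at hx
    linarith
  have h1θ : (1 - θ) ≠ 0 := fun h => hθ1 (by linarith)
  have hn2 : ∀ n : ℕ, (n : ℝ) + 2 - θ ≠ 0 := by
    intro n h
    apply hθ (n + 1)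
    push_cast
    linarith
  have hgeo : ∀ q : ℝ, 0 < q → b * q < c → Summable (fun n : ℕ => (b * q / c) ^ (n + 1)) := by
    intro q hq hqc
    have h0 : 0 ≤ b * q / c := by positivity
    have h1 : b * q / c < 1 := by
      rw [div_lt_one hc]
      exact hqc
    exact (summable_nat_add_iff 1).2 (summable_geometric_of_lt_one h0 h1)
  have hsum : Summable (fun n : ℕ =>
      |(-b / c) ^ (n + 1) * x ^ ((n : ℝ) + 2 - θ) / ((n : ℝ) + 2 - θ)|) := by
    refine Summable.of_norm_bounded_eventually_nat ((hgeo x hx0 hbx).mul_left (x ^ (1 - θ))) ?_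
    filter_upwards [Filter.eventually_ge_atTop (⌈θ⌉₊)] with n hn
    have hnθ : θ ≤ n := (Nat.le_ceil θ).trans (by exact_mod_cast hn)
    have e : x ^ ((n : ℝ) + 2 - θ) = x ^ (1 - θ) * x ^ (n + 1) := by
      rw [← Real.rpow_natCast, ← Real.rpow_add hx0]
      congr 1
      push_cast
      ring
    have hp : 0 < x ^ (1 - θ) := Real.rpow_pos_of_pos hx0 _
    have hd : 1 ≤ (n : ℝ) + 2 - θ := by linarith
    rw [norm_abs_eq_norm, Real.norm_eq_abs, abs_div, abs_of_pos (by linarith : 0 < (n : ℝ) + 2 - θ)]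
    refine (div_le_self (abs_nonneg _) hd).trans (le_of_eq ?_)
    rw [e, abs_mul, abs_mul, abs_pow, abs_of_pos hp, abs_of_pos (pow_pos hx0 _), abs_div, abs_neg,
      abs_of_pos hb, abs_of_pos hc, mul_div_right_comm, mul_pow]
    ring
  refine ⟨hsum, ?_⟩
  obtain ⟨d, hxd, hdc⟩ := exists_between hx
  have hd0 : 0 < d := hx0.trans hxd
  have hbd : b * d < c := by
    rw [lt_div_iff₀ hb] at hdc
    linarith
  have hg'eq : ∀ (n : ℕ) (y : ℝ), 0 < y →
      (-b / c) ^ (n + 1) * y ^ ((n : ℝ) + 1 - θ) = y ^ (-θ) * (-(b * y / c)) ^ (n + 1) := by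
    intro n y hy
    have e : y ^ ((n : ℝ) + 1 - θ) = y ^ (-θ) * y ^ (n + 1) := by
      rw [← Real.rpow_natCast, ← Real.rpow_add hy]
      congr 1
      push_cast
      ring
    have e2 : -(b * y / c) = (-b / c) * y := by ring
    rw [e, e2, mul_pow]
    ring
  have hder := hasDerivAt_tsum_of_isPreconnected (𝕜 := ℝ) (F := ℝ)
    (g := fun (n : ℕ) (y : ℝ) => (-b / c) ^ (n + 1) * y ^ ((n : ℝ) + 2 - θ) / ((n : ℝ) + 2 - θ))
    (g' := fun (n : ℕ) (y : ℝ) => (-b / c) ^ (n + 1) * y ^ ((n : ℝ) + 1 - θ))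
    (u := fun n : ℕ => ((x / 2) ^ (-θ) + d ^ (-θ)) * (b * d / c) ^ (n + 1))
    (t := Set.Ioo (x / 2) d) (y₀ := x) (y := x)
    ((hgeo d hd0 hbd).mul_left _) isOpen_Ioo isPreconnected_Ioo
    (by
      intro n y hy
      have hy0 : 0 < y := by linarith [hy.1]
      have h := ((Real.hasDerivAt_rpow_const (x := y) (p := (n : ℝ) + 2 - θ)
        (Or.inl hy0.ne')).const_mul ((-b / c) ^ (n + 1))).div_const ((n : ℝ) + 2 - θ)
      refine h.congr_deriv ?_
      rw [show (n : ℝ) + 2 - θ - 1 = (n : ℝ) + 1 - θ by ring]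
      have := hn2 n
      rw [div_eq_iff this]
      ring)
    (by
      intro n y hy
      have hx2 : 0 < x / 2 := by linarith
      have hy0 : 0 < y := by linarith [hy.1]
      have hyd : y < d := hy.2
      beta_reduce
      rw [hg'eq n y hy0, norm_mul, norm_pow, norm_neg, Real.norm_of_nonneg (by positivity),
        Real.norm_of_nonneg (by positivity)]
      have hA : 0 < (x / 2) ^ (-θ) := Real.rpow_pos_of_pos hx2 _
      have hB : 0 < d ^ (-θ) := Real.rpow_pos_of_pos hd0 _
      have hM : y ^ (-θ) ≤ (x / 2) ^ (-θ) + d ^ (-θ) := by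
        rcases le_total 0 (-θ) with h | h
        · have := Real.rpow_le_rpow hy0.le hyd.le h
          linarith
        · have := Real.rpow_le_rpow_of_nonpos hx2 hy.1.le h
          linarith
      gcongr)
    ⟨by linarith, hxd⟩ hsum.of_abs ⟨by linarith, hxd⟩
  have hval : ∑' n : ℕ, (-b / c) ^ (n + 1) * x ^ ((n : ℝ) + 1 - θ)
      = - (x ^ (-θ) * (b * x / (b * x + c))) := by
    simp_rw [fun n => hg'eq n x hx0]
    rw [tsum_mul_left]
    simp_rw [pow_succ]
    have hr : |(-(b * x / c))| < 1 := by
      rw [abs_neg, abs_of_pos (by positivity), div_lt_one hc]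
      exact hbx
    rw [tsum_mul_right, tsum_geometric_of_abs_lt_one hr]
    have : 1 - -(b * x / c) = (b * x + c) / c := by
      field_simp
      ring
    rw [this]
    have : b * x + c ≠ 0 := by positivity
    field_simp
  beta_reduce at hder
  rw [hval] at hder
  have hpos : b * x + c ≠ 0 := by positivity
  have hl : HasDerivAt (fun y : ℝ => Real.log (b * y + c)) (b / (b * x + c)) x := by
    have h := (((hasDerivAt_id x).const_mul b).add_const c).log (by simpa using hpos)
    simpa using h
  have hmain := (((Real.hasDerivAt_rpow_const (x := x) (p := 1 - θ)
    (Or.inl hx0.ne')).mul hl).div_const (1 - θ)).add (hder.const_mul (1 / (1 - θ)))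
  refine HasDerivAt.congr_deriv hmain ?_
  have e1 : (1 - θ - 1) = -θ := by ring
  have e2 : x ^ (1 - θ) = x ^ (-θ) * x := by
    rw [show 1 - θ = -θ + 1 by ring, Real.rpow_add_one hx0.ne']
  rw [e1, e2]
  field_simp
  ring
end

section
/- Let α > 0, β ∈ ℝ, h ≠ 0, let P > 0 be the power of the user of interest, and let I = S + α²/h² where S ≥ 0 is the total interference power of subsequent SIC layers. Define the Shannon–Hartley rate R_sh = (1/2) log(1 + P/I) and the ambient-light-impaired rate R = R_sh − β²P/(I(P + I)). Then 0 ≤ R_sh − R ≤ β² h²/α². In particular, for fixed P, S, α, h, the rate R converges to R_sh as β → 0. -/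
open Real Filter

/-- The gap between the Shannon–Hartley rate `R_sh = ½ log(1 + P/I)` and the
ambient-light-impaired rate `R = R_sh − β²P/(I(P+I))`, with `I = S + α²/h²`, satisfies
`0 ≤ R_sh − R ≤ β²h²/α²`; in particular `R → R_sh` as `β → 0`. -/
theorem rate_gap_ambient_light
    (α β h P S I Rsh R : ℝ) (hα : 0 < α) (hh : h ≠ 0) (hP : 0 < P) (hS : 0 ≤ S)
    (hI : I = S + α ^ 2 / h ^ 2)
    (hRsh : Rsh = (1 / 2) * Real.log (1 + P / I))
    (hR : R = Rsh - β ^ 2 * P / (I * (P + I))) :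
    (0 ≤ Rsh - R ∧ Rsh - R ≤ β ^ 2 * h ^ 2 / α ^ 2) ∧
    Tendsto (fun b : ℝ => Rsh - b ^ 2 * P / (I * (P + I))) (nhds 0) (nhds Rsh) := by
  have hh2 : 0 < h ^ 2 := by positivity
  have hq : 0 < α ^ 2 / h ^ 2 := by positivity
  have hIpos : 0 < I := by rw [hI]; linarith
  have hIge : α ^ 2 / h ^ 2 ≤ I := by rw [hI]; linarith
  have hgap : Rsh - R = β ^ 2 * P / (I * (P + I)) := by rw [hR]; ring
  refine ⟨⟨?_, ?_⟩, ?_⟩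
  · rw [hgap]; positivity
  · rw [hgap]
    have h1 : β ^ 2 * P / (I * (P + I)) ≤ β ^ 2 / I := by
      rw [div_le_div_iff₀ (by positivity) hIpos]
      have : 0 ≤ β ^ 2 * I * I := by positivity
      nlinarith
    have h2 : β ^ 2 / I ≤ β ^ 2 / (α ^ 2 / h ^ 2) :=
      div_le_div_of_nonneg_left (by positivity) hq hIge
    have h3 : β ^ 2 / (α ^ 2 / h ^ 2) = β ^ 2 * h ^ 2 / α ^ 2 := by
      field_simp
    linarith
  · have hc : Continuous (fun b : ℝ => Rsh - b ^ 2 * P / (I * (P + I))) := by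
      fun_prop
    have := hc.tendsto 0
    simpa using this
end
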